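/- Let n ≥ 3 and f₁, …, fₙ be nonzero univariate polynomials over ℂ, not all constant, with gcd{f₁,…,fₙ} = 1, f₁ + ⋯ + fₙ = 0, and no proper nonempty subsum vanishing. Let d be the dimension of the ℂ-span of the fᵢ. Then there exists σ with 1 ≤ σ ≤ d(d−1)/2 such that max₁≤m≤n deg fₘ ≤ r_σ(f₁f₂⋯fₙ) − σ. -/

import Mathlib

open Polynomial

/-- The radical of `g`: product of the distinct monic linear factors of `g`. -/
noncomputable def rad (g : ℂ[X]) : ℂ[X] := ∏ a ∈ g.roots.toFinset, (X - C a)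

/-- `radE e g = gcd (g, rad(g)^e)`, the `(e+1)`-th-power-free part of `g`. -/
noncomputable def radE (e : ℕ) (g : ℂ[X]) : ℂ[X] := EuclideanDomain.gcd g (rad g ^ e)

/-- `rE e g` is the degree of `radE e g`. -/
noncomputable def rE (e : ℕ) (g : ℂ[X]) : ℕ := (radE e g).natDegree

noncomputable def wrm {m : ℕ} (g : Fin m → ℂ[X]) : Matrix (Fin m) (Fin m) ℂ[X] :=
  Matrix.of fun i j => derivative^[(j : ℕ)] (g i)

noncomputable def wr {m : ℕ} (g : Fin m → ℂ[X]) : ℂ[X] := (wrm g).det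

lemma wr_mul_pow {m : ℕ} (g : Fin m → ℂ[X]) (q : ℂ[X]) :
    q ^ (∑ j : Fin m, (j : ℕ)) * wr g =
      (Matrix.of fun i j : Fin m => q ^ (j : ℕ) * derivative^[(j : ℕ)] (g i)).det := by
  rw [← Finset.prod_pow_eq_pow_sum, wr, ← Matrix.det_mul_row]
  rfl

lemma wr_dvd {m : ℕ} (g : Fin m → ℂ[X]) (q : ℂ[X]) (v : Fin m → ℕ)
    (h : ∀ i, q ^ v i ∣ g i) :
    q ^ (∑ i, v i) ∣ q ^ (∑ j : Fin m, (j : ℕ)) * wr g := by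
  rw [wr_mul_pow]
  have key : ∀ i j : Fin m, q ^ v i ∣ q ^ (j : ℕ) * derivative^[(j : ℕ)] (g i) := by
    intro i j
    have h1 := pow_sub_dvd_iterate_derivative_of_pow_dvd (j : ℕ) (h i)
    calc q ^ v i ∣ q ^ ((j : ℕ) + (v i - j)) := pow_dvd_pow _ (by omega)
      _ = q ^ (j : ℕ) * q ^ (v i - j) := pow_add _ _ _
      _ ∣ _ := mul_dvd_mul_left _ h1
  choose N hN using key
  have : (Matrix.of fun i j : Fin m => q ^ (j : ℕ) * derivative^[(j : ℕ)] (g i)) =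
      Matrix.of fun i j => q ^ v i * (Matrix.of N) i j := by
    ext1 i j
    simp [hN]
  rw [this, Matrix.det_mul_column (fun i => q ^ v i) (Matrix.of N), Finset.prod_pow_eq_pow_sum]
  exact dvd_mul_right _ _

lemma entry_deg (p : ℂ[X]) (j : ℕ) : (X ^ j * derivative^[j] p).natDegree ≤ p.natDegree := by
  by_cases h : p.natDegree < j
  · simp [iterate_derivative_eq_zero h]
  · have h1 := natDegree_iterate_derivative p j
    have h2 := natDegree_mul_le (p := (X : ℂ[X]) ^ j) (q := derivative^[j] p)
    rw [natDegree_X_pow] at h2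
    omega

lemma entry_coeff (p : ℂ[X]) (j : ℕ) : (X ^ j * derivative^[j] p).coeff p.natDegree
    = p.leadingCoeff * (descPochhammer ℂ j).eval (p.natDegree : ℂ) := by
  rw [descPochhammer_eval_eq_descFactorial]
  by_cases h : p.natDegree < j
  · simp [iterate_derivative_eq_zero h, Nat.descFactorial_of_lt h]
  · rw [coeff_X_pow_mul', if_pos (by omega), coeff_iterate_derivative]
    rw [Nat.sub_add_cancel (by omega)]
    simp [mul_comm]

lemma wr_deg {m : ℕ} (g : Fin m → ℂ[X]) (h : wr g ≠ 0) :
    (wr g).natDegree + ∑ j : Fin m, (j : ℕ) ≤ ∑ i, (g i).natDegree := by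
  have h1 := congrArg natDegree (wr_mul_pow g X)
  rw [natDegree_mul (pow_ne_zero _ X_ne_zero) h, natDegree_X_pow, add_comm] at h1
  rw [h1, Matrix.det_apply]
  apply natDegree_sum_le_of_forall_le
  intro s _
  refine (natDegree_smul_le _ _).trans ((natDegree_prod_le _ _).trans ?_)
  rw [← Equiv.sum_comp s (fun i => (g i).natDegree)]
  exact Finset.sum_le_sum fun i _ => entry_deg _ _

lemma coeff_prod_sum {ι : Type*} (s : Finset ι) (p : ι → ℂ[X]) (d : ι → ℕ)
    (h : ∀ i ∈ s, (p i).natDegree ≤ d i) :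
    (∏ i ∈ s, p i).coeff (∑ i ∈ s, d i) = ∏ i ∈ s, (p i).coeff (d i) := by
  classical
  induction s using Finset.induction_on with
  | empty => simp
  | insert a s ha ih =>
    rw [Finset.prod_insert ha, Finset.sum_insert ha, Finset.prod_insert ha,
      coeff_mul_add_eq_of_natDegree_le, ih]
    · exact fun i hi => h i (Finset.mem_insert_of_mem hi)
    · exact h a (Finset.mem_insert_self _ _)
    · exact (natDegree_prod_le _ _).trans
        (Finset.sum_le_sum fun i hi => h i (Finset.mem_insert_of_mem hi))

lemma coeff_det_sum {m : ℕ} (M : Matrix (Fin m) (Fin m) ℂ[X]) (d : Fin m → ℕ)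
    (h : ∀ i j, (M i j).natDegree ≤ d i) :
    M.det.coeff (∑ i, d i) = (Matrix.of fun i j => (M i j).coeff (d i)).det := by
  rw [Matrix.det_apply', Matrix.det_apply', finsetSum_coeff]
  refine Finset.sum_congr rfl fun s _ => ?_
  rw [← Equiv.sum_comp s d, ← C_eq_intCast, coeff_C_mul, coeff_prod_sum _ _ _ (fun i _ => h _ _)]
  simp

lemma wr_ne_zero_of_inj {m : ℕ} (g : Fin m → ℂ[X]) (h0 : ∀ i, g i ≠ 0)
    (hinj : Function.Injective fun i => (g i).natDegree) : wr g ≠ 0 := by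
  intro hw
  have h1 := wr_mul_pow g X
  rw [hw, mul_zero] at h1
  have h2 := coeff_det_sum (Matrix.of fun i j : Fin m => X ^ (j : ℕ) * derivative^[(j : ℕ)] (g i))
    (fun i => (g i).natDegree) (fun i j => entry_deg _ _)
  rw [← h1, coeff_zero] at h2
  simp only [Matrix.of_apply, entry_coeff] at h2
  have h3 := Matrix.det_mul_column (fun i => (g i).leadingCoeff)
    (Matrix.of fun i j : Fin m => (descPochhammer ℂ (j : ℕ)).eval ((g i).natDegree : ℂ))
  simp only [Matrix.of_apply] at h3
  rw [h3, ← Matrix.det_eval_matrixOfPolynomials_eq_det_vandermonde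
    (fun i => ((g i).natDegree : ℂ)) (fun j : Fin m => descPochhammer ℂ (j : ℕ))
    (fun i => descPochhammer_natDegree ℂ i) (fun i => monic_descPochhammer ℂ i)] at h2
  rcases mul_eq_zero.1 h2.symm with h | h
  · obtain ⟨i, -, hi⟩ := Finset.prod_eq_zero_iff.1 h
    exact h0 i (leadingCoeff_eq_zero.1 hi)
  · refine Matrix.det_vandermonde_ne_zero_iff.2 ?_ h
    intro i j hij
    exact hinj (by simpa using hij)

lemma wrm_update {m : ℕ} (g : Fin m → ℂ[X]) (i : Fin m) (p : ℂ[X]) :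
    wrm (Function.update g i p) =
      (wrm g).updateRow i (fun j => derivative^[(j : ℕ)] p) := by
  ext1 k j
  by_cases h : k = i
  · subst h; simp [wrm]
  · simp [wrm, h, Matrix.updateRow_apply]

lemma wr_update_sum {m : ℕ} (g : Fin m → ℂ[X]) (i : Fin m) (c : Fin m → ℂ) :
    wr (Function.update g i (∑ k, c k • g k)) = C (c i) * wr g := by
  have := Matrix.det_updateRow_sum (wrm g) i (fun k => C (c k))
  rw [smul_eq_mul] at this
  rw [wr, wr, ← this, wrm_update]
  congr 2
  funext j
  rw [iterate_derivative_sum, Finset.sum_apply]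
  simp [wrm, smul_eq_C_mul]

lemma wr_ne_zero {m : ℕ} (N : ℕ) : ∀ g : Fin m → ℂ[X], ∑ i, (g i).natDegree ≤ N →
    LinearIndependent ℂ g → wr g ≠ 0 := by
  induction N using Nat.strong_induction_on with
  | _ N ih =>
  intro g hN hg
  by_cases hinj : Function.Injective fun i => (g i).natDegree
  · exact wr_ne_zero_of_inj g hg.ne_zero hinj
  simp only [Function.Injective, not_forall] at hinj
  obtain ⟨i, j, hdeg, hij⟩ := hinj
  set c : ℂ := -((g i).leadingCoeff / (g j).leadingCoeff) with hc
  have hj0 : (g j).leadingCoeff ≠ 0 := leadingCoeff_ne_zero.2 (hg.ne_zero j)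
  have hi0 : (g i).leadingCoeff ≠ 0 := leadingCoeff_ne_zero.2 (hg.ne_zero i)
  set p : ℂ[X] := g i + c • g j with hp
  have hg' : LinearIndependent ℂ (Function.update g i p) := by
    have := (linearIndependent_add_smul_iff (R := ℂ) (v := g) (c := Pi.single i c) (i := j)
      (by simp [Ne.symm hij])).2 hg
    have heq : Function.update g i p = g + fun x => (Pi.single i c : Fin m → ℂ) x • g j := by
      funext k
      by_cases h : k = i
      · subst h; simp [hp]
      · simp [h]
    rw [heq]
    exact this
  have hp0 : p ≠ 0 := by simpa using hg'.ne_zero i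
  have hple : p.natDegree ≤ (g i).natDegree :=
    (natDegree_add_le _ _).trans (max_le le_rfl ((natDegree_smul_le _ _).trans hdeg.symm.le))
  have hpne : p.natDegree ≠ (g i).natDegree := by
    intro h
    have h1 : p.leadingCoeff = 0 := by
      rw [leadingCoeff, h, hp, coeff_add, coeff_smul]
      have hd : (g i).natDegree = (g j).natDegree := hdeg
      have : (g j).coeff (g i).natDegree = (g j).leadingCoeff := by rw [hd]; rfl
      rw [this, coeff_natDegree, hc, smul_eq_mul]
      field_simp
      ring
    exact hp0 (leadingCoeff_eq_zero.1 h1)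
  have hlt : ∑ k, (Function.update g i p k).natDegree < ∑ k, (g k).natDegree := by
    refine Finset.sum_lt_sum (fun k _ => ?_) ⟨i, Finset.mem_univ _, ?_⟩
    · by_cases h : k = i
      · subst h; simpa using hple
      · simp [h]
    · simpa using lt_of_le_of_ne hple hpne
  have h1 := ih _ (lt_of_lt_of_le hlt hN) _ le_rfl hg'
  have hsum : p = ∑ k, (Pi.single i 1 + Pi.single j c : Fin m → ℂ) k • g k := by
    simp [add_smul, Finset.sum_add_distrib, Pi.single_apply, hp]
  rw [hsum, wr_update_sum] at h1
  exact right_ne_zero_of_mul h1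

lemma exists_block {n : ℕ} (f : Fin n → ℂ[X]) (S I₀ : Finset (Fin n)) (hI₀ : Disjoint S I₀)
    (u₀ : ℂ[X]) (hu₀ : u₀ ≠ 0) (huS : u₀ ∈ Submodule.span ℂ (f '' (S : Set (Fin n))))
    (huI : u₀ ∈ Submodule.span ℂ (f '' (I₀ : Set (Fin n)))) :
    ∃ I : Finset (Fin n), Disjoint S I ∧ I.Nonempty ∧
      LinearIndepOn ℂ f (I : Set (Fin n)) ∧
      (∃ u : ℂ[X], ∃ c : Fin n → ℂ, u ≠ 0 ∧ u ∈ Submodule.span ℂ (f '' (S : Set (Fin n))) ∧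
        ∑ i ∈ I, c i • f i = u ∧ ∀ i ∈ I, c i ≠ 0) ∧
      Module.finrank ℂ (Submodule.span ℂ (f '' (S : Set (Fin n)))) + I.card ≤
        Module.finrank ℂ (Submodule.span ℂ (f '' ((S ∪ I : Finset (Fin n)) : Set (Fin n)))) + 1 := by
  classical
  let P : Finset (Fin n) → Prop := fun I => Disjoint S I ∧ ∃ u : ℂ[X], u ≠ 0 ∧
    u ∈ Submodule.span ℂ (f '' (S : Set (Fin n))) ∧ u ∈ Submodule.span ℂ (f '' (I : Set (Fin n)))
  have hex : ∃ k, ∃ I, P I ∧ I.card = k := ⟨_, I₀, ⟨hI₀, u₀, hu₀, huS, huI⟩, rfl⟩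
  obtain ⟨I, ⟨hdis, u, hu, huS, huI⟩, hcard⟩ := Nat.find_spec hex
  have hmin : ∀ J, P J → I.card ≤ J.card := fun J hJ => by
    rw [hcard]; exact Nat.find_min' hex ⟨J, hJ, rfl⟩
  have hnP : ∀ i ∈ I, ¬ P (I.erase i) := fun i hi h => by
    have := hmin _ h
    have := Finset.card_erase_lt_of_mem hi
    omega
  have hdis' : ∀ i, Disjoint S (I.erase i) := fun i =>
    Finset.disjoint_of_subset_right (Finset.erase_subset _ _) hdis
  obtain ⟨c, hc⟩ := (Submodule.mem_span_image_finset_iff_exists_fun' ℂ).1 huI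
  have key : ∀ b : Fin n → ℂ, ∑ k ∈ I, b k • f k = u → ∀ i ∈ I, b i ≠ 0 := by
    intro b hb i hi h0
    refine hnP i hi ⟨hdis' i, u, hu, huS, ?_⟩
    refine (Submodule.mem_span_image_finset_iff_exists_fun' ℂ).2 ⟨b, ?_⟩
    rw [← hb, ← Finset.add_sum_erase _ _ hi, h0]
    simp
  have hne : I.Nonempty := by
    rw [Finset.nonempty_iff_ne_empty]
    rintro rfl
    simp at hc
    exact hu hc.symm
  have hli : LinearIndepOn ℂ f (I : Set (Fin n)) := by
    rw [linearIndepOn_finset_iff]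
    intro b hb i hi
    by_contra hbi
    refine key (fun k => c k - c i / b i * b k) ?_ i hi (by field_simp; simp)
    simp only [sub_smul, Finset.sum_sub_distrib, mul_smul, ← Finset.smul_sum, hb, hc]
    simp
  refine ⟨I, hdis, hne, hli, ⟨u, c, hu, huS, hc, key c hc⟩, ?_⟩
  obtain ⟨i, hi⟩ := hne
  have hd : Disjoint (Submodule.span ℂ (f '' (S : Set (Fin n))))
      (Submodule.span ℂ (f '' ((I.erase i : Finset (Fin n)) : Set (Fin n)))) := by
    rw [Submodule.disjoint_def]
    intro x hx hx'
    by_contra hx0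
    exact hnP i hi ⟨hdis' i, x, hx0, hx, hx'⟩
  have hfd : ∀ T : Finset (Fin n),
      FiniteDimensional ℂ (Submodule.span ℂ (f '' (T : Set (Fin n)))) := fun T =>
    FiniteDimensional.span_of_finite ℂ (T.finite_toSet.image f)
  have := hfd S
  have := hfd (I.erase i)
  have := hfd (S ∪ I)
  have h1 := Submodule.finrank_sup_add_finrank_inf_eq (Submodule.span ℂ (f '' (S : Set (Fin n))))
    (Submodule.span ℂ (f '' ((I.erase i : Finset (Fin n)) : Set (Fin n))))
  rw [hd.eq_bot, finrank_bot, add_zero] at h1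
  have h2 : Module.finrank ℂ (Submodule.span ℂ (f '' ((I.erase i : Finset (Fin n)) : Set (Fin n))))
      = (I.erase i).card := by
    have h3 : LinearIndepOn ℂ f ((I.erase i : Finset (Fin n)) : Set (Fin n)) :=
      hli.mono (by exact_mod_cast Finset.erase_subset i I)
    have h4 := finrank_span_eq_card h3
    rw [Set.image_eq_range]
    rw [h4]
    exact Fintype.card_coe (I.erase i)
  have h5 := Submodule.finrank_mono (R := ℂ)
    (s := Submodule.span ℂ (f '' (S : Set (Fin n))) ⊔
      Submodule.span ℂ (f '' ((I.erase i : Finset (Fin n)) : Set (Fin n))))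
    (t := Submodule.span ℂ (f '' ((S ∪ I : Finset (Fin n)) : Set (Fin n))))
    (sup_le (Submodule.span_mono (Set.image_mono (by simp)))
      (Submodule.span_mono (Set.image_mono (by
        intro x hx
        simp at hx ⊢
        exact Or.inr hx.1))))
  rw [Finset.card_erase_of_mem hi] at h2
  have := Finset.card_pos.2 ⟨i, hi⟩
  omega

lemma sum_fin_val (m : ℕ) : 2 * ∑ j : Fin m, (j : ℕ) = m * (m - 1) := by
  rw [Fin.sum_univ_eq_sum_range (fun i => i) m, mul_comm, Finset.sum_range_id_mul_two]

/-- The Wronskian of a block, with its estimates. -/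
lemma block_wr {n : ℕ} (f : Fin n → ℂ[X]) (hne : ∀ i, f i ≠ 0) (I : Finset (Fin n))
    (hli : LinearIndepOn ℂ f (I : Set (Fin n))) (u : ℂ[X]) (c : Fin n → ℂ) (hu : u ≠ 0)
    (hc : ∑ i ∈ I, c i • f i = u) (hc0 : ∀ i ∈ I, c i ≠ 0) :
    ∃ (W : ℂ[X]) (τ : ℕ), W ≠ 0 ∧ 2 * τ = I.card * (I.card - 1) ∧
      (∀ a, ∑ i ∈ I, (f i).rootMultiplicity a ≤ W.rootMultiplicity a + τ) ∧
      (∀ a, ∀ i ∈ I, u.rootMultiplicity a + ∑ k ∈ I, (f k).rootMultiplicity a ≤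
        W.rootMultiplicity a + τ + (f i).rootMultiplicity a) ∧
      (W.natDegree + τ ≤ ∑ i ∈ I, (f i).natDegree) ∧
      (∀ i ∈ I, W.natDegree + τ + (f i).natDegree ≤
        u.natDegree + ∑ k ∈ I, (f k).natDegree) := by
  classical
  let e : Fin I.card ≃ I := I.equivFin.symm
  let g : Fin I.card → ℂ[X] := fun k => f (e k)
  have hg : LinearIndependent ℂ g := LinearIndependent.comp hli e e.injective
  have hW : wr g ≠ 0 := wr_ne_zero _ g le_rfl hg
  have hsumI : ∀ F : Fin n → ℕ, ∑ k, F (e k) = ∑ i ∈ I, F i := fun F => by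
    rw [Equiv.sum_comp e (fun i : I => F i), Finset.sum_coe_sort]
  have hcu : ∑ k, c (e k) • g k = u := by
    rw [← hc, ← Finset.sum_coe_sort I, ← Equiv.sum_comp e]
  have mult : ∀ (h : Fin I.card → ℂ[X]) (a : ℂ), wr h ≠ 0 →
      ∑ k, (h k).rootMultiplicity a ≤ (wr h).rootMultiplicity a + ∑ j : Fin I.card, (j : ℕ) := by
    intro h a h0
    have h1 := wr_dvd h (X - C a) (fun k => (h k).rootMultiplicity a)
      (fun k => pow_rootMultiplicity_dvd _ _)
    have h2 : (X - C a) ^ (∑ j : Fin I.card, (j : ℕ)) * wr h ≠ 0 :=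
      mul_ne_zero (pow_ne_zero _ (X_sub_C_ne_zero a)) h0
    rw [← le_rootMultiplicity_iff h2, rootMultiplicity_mul h2, rootMultiplicity_X_sub_C_pow] at h1
    omega
  have hup : ∀ k, wr (Function.update g k u) = C (c (e k)) * wr g := fun k => by
    rw [← hcu, wr_update_sum g k (fun k => c (e k))]
  have hck : ∀ k, c (e k) ≠ 0 := fun k => hc0 _ (e k).2
  have hup0 : ∀ k, wr (Function.update g k u) ≠ 0 := fun k => by
    rw [hup]; exact mul_ne_zero (C_ne_zero.2 (hck k)) hW
  have hsumup : ∀ (F : ℂ[X] → ℕ) k, ∑ l, F (Function.update g k u l) + F (g k) =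
      F u + ∑ i ∈ I, F (f i) := by
    intro F k
    rw [← hsumI (fun i => F (f i)), ← Finset.add_sum_erase _ _ (Finset.mem_univ k),
      ← Finset.add_sum_erase _ (fun l => F (f (e l))) (Finset.mem_univ k)]
    have : ∑ x ∈ Finset.univ.erase k, F (Function.update g k u x) =
        ∑ x ∈ Finset.univ.erase k, F (f (e x)) :=
      Finset.sum_congr rfl fun x hx => by
        rw [Function.update_of_ne (Finset.ne_of_mem_erase hx)]
    rw [this, Function.update_self]
    show F u + _ + F (f (e k)) = _
    omega
  refine ⟨wr g, ∑ j : Fin I.card, (j : ℕ), hW, sum_fin_val _, ?_, ?_, ?_, ?_⟩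
  · intro a
    rw [← hsumI]
    exact mult g a hW
  · intro a i hi
    have h1 := mult _ a (hup0 (e.symm ⟨i, hi⟩))
    have h2 := hsumup (fun p => p.rootMultiplicity a) (e.symm ⟨i, hi⟩)
    have h3 : g (e.symm ⟨i, hi⟩) = f i := by simp [g]
    rw [hup, rootMultiplicity_mul (mul_ne_zero (C_ne_zero.2 (hck _)) hW),
      rootMultiplicity_C] at h1
    rw [h3] at h2
    omega
  · rw [← hsumI]
    exact wr_deg g hW
  · intro i hi
    have h1 := wr_deg _ (hup0 (e.symm ⟨i, hi⟩))
    have h2 := hsumup natDegree (e.symm ⟨i, hi⟩)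
    have h3 : g (e.symm ⟨i, hi⟩) = f i := by simp [g]
    rw [hup, natDegree_C_mul (hck _)] at h1
    rw [h3] at h2
    omega

def Good {n : ℕ} (f : Fin n → ℂ[X]) (S : Finset (Fin n)) : Prop :=
  ∃ (W : ℂ[X]) (σ D : ℕ), W ≠ 0 ∧ 1 ≤ D ∧ 2 * σ ≤ D * (D - 1) ∧
    D ≤ Module.finrank ℂ (Submodule.span ℂ (f '' (S : Set (Fin n)))) ∧
    (∀ a, ∀ i ∈ S, ∑ k ∈ S, (f k).rootMultiplicity a ≤
      W.rootMultiplicity a + σ + (f i).rootMultiplicity a) ∧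
    (∀ i ∈ S, W.natDegree + σ + (f i).natDegree ≤ ∑ k ∈ S, (f k).natDegree)

lemma good_singleton {n : ℕ} (f : Fin n → ℂ[X]) (hne : ∀ i, f i ≠ 0) (i : Fin n) :
    Good f {i} := by
  refine ⟨1, 0, 1, one_ne_zero, le_rfl, by simp, ?_, ?_, ?_⟩
  · rw [Finset.coe_singleton, Set.image_singleton, finrank_span_singleton (hne i)]
  · simp
  · simp

lemma exists_mult_le {n : ℕ} (f : Fin n → ℂ[X]) (S : Finset (Fin n)) (hS : S.Nonempty)
    (u : ℂ[X]) (hu : u ≠ 0) (huS : u ∈ Submodule.span ℂ (f '' (S : Set (Fin n)))) (a : ℂ) :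
    ∃ k ∈ S, (f k).rootMultiplicity a ≤ u.rootMultiplicity a := by
  obtain ⟨k, hk, hmin⟩ := S.exists_min_image (fun k => (f k).rootMultiplicity a) hS
  refine ⟨k, hk, (le_rootMultiplicity_iff hu).2 ?_⟩
  obtain ⟨c, rfl⟩ := (Submodule.mem_span_image_finset_iff_exists_fun' ℂ).1 huS
  refine Finset.dvd_sum fun i hi => ?_
  rw [smul_eq_C_mul]
  exact ((pow_dvd_pow _ (hmin i hi)).trans (pow_rootMultiplicity_dvd _ _)).mul_left _

lemma exists_deg_le {n : ℕ} (f : Fin n → ℂ[X]) (S : Finset (Fin n)) (hS : S.Nonempty)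
    (u : ℂ[X]) (huS : u ∈ Submodule.span ℂ (f '' (S : Set (Fin n)))) :
    ∃ k ∈ S, u.natDegree ≤ (f k).natDegree := by
  obtain ⟨k, hk, hmax⟩ := S.exists_max_image (fun k => (f k).natDegree) hS
  refine ⟨k, hk, ?_⟩
  obtain ⟨c, rfl⟩ := (Submodule.mem_span_image_finset_iff_exists_fun' ℂ).1 huS
  exact natDegree_sum_le_of_forall_le _ _ fun i hi => (natDegree_smul_le _ _).trans (hmax i hi)

lemma good_step {n : ℕ} (f : Fin n → ℂ[X]) (hne : ∀ i, f i ≠ 0) (hsum : ∑ i, f i = 0)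
    (hsub : ∀ S : Finset (Fin n), S.Nonempty → S ≠ Finset.univ → ∑ i ∈ S, f i ≠ 0)
    (S : Finset (Fin n)) (hS : S.Nonempty) (hSu : S ≠ Finset.univ) (hG : Good f S) :
    ∃ S', S ⊂ S' ∧ Good f S' := by
  classical
  have hS0 := hsub S hS hSu
  obtain ⟨I, hdis, hIne, hli, ⟨u, c, hu, huS, hc, hc0⟩, hdim⟩ :=
    exists_block f S Sᶜ disjoint_compl_right (∑ i ∈ S, f i) hS0
      (Submodule.sum_mem _ fun i hi => Submodule.subset_span ⟨i, hi, rfl⟩)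
      (by
        have h1 : ∑ i ∈ S, f i = - ∑ i ∈ Sᶜ, f i := by
          rw [eq_neg_iff_add_eq_zero, Finset.sum_add_sum_compl, hsum]
        rw [h1]
        exact Submodule.neg_mem _
          (Submodule.sum_mem _ fun i hi => Submodule.subset_span ⟨i, hi, rfl⟩))
  obtain ⟨W₂, τ, hW₂, hτ, m1, m2, d1, d2⟩ := block_wr f hne I hli u c hu hc hc0
  obtain ⟨W, σ, D, hW, hD, hσ, hDle, hm, hd⟩ := hG
  refine ⟨S ∪ I, ?_, W * W₂, σ + τ, D + I.card - 1, mul_ne_zero hW hW₂, ?_, ?_, ?_, ?_, ?_⟩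
  · obtain ⟨i, hi⟩ := hIne
    refine Finset.ssubset_iff_subset_ne.2 ⟨Finset.subset_union_left, fun h => ?_⟩
    have : i ∈ S := by rw [h]; exact Finset.mem_union_right _ hi
    exact Finset.disjoint_left.1 hdis this hi
  · have := hIne.card_pos
    omega
  · obtain ⟨D, rfl⟩ : ∃ D', D = D' + 1 := ⟨D - 1, by omega⟩
    obtain ⟨k, hk⟩ : ∃ k, I.card = k + 1 := ⟨I.card - 1, by have := hIne.card_pos; omega⟩
    rw [hk] at hτ ⊢
    have e1 : D + 1 + (k + 1) - 1 = D + k + 1 := by omega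
    rw [e1]
    simp only [Nat.add_sub_cancel] at *
    nlinarith [Nat.zero_le (D * k)]
  · omega
  · intro a i hi
    rw [Finset.sum_union hdis, rootMultiplicity_mul (mul_ne_zero hW hW₂)]
    rcases Finset.mem_union.1 hi with hi | hi
    · have := hm a i hi
      have := m1 a
      omega
    · obtain ⟨k, hk, hku⟩ := exists_mult_le f S hS u hu huS a
      have := hm a k hk
      have := m2 a i hi
      omega
  · intro i hi
    rw [Finset.sum_union hdis, natDegree_mul hW hW₂]
    rcases Finset.mem_union.1 hi with hi | hi
    · have := hd i hi
      omega
    · obtain ⟨k, hk, hku⟩ := exists_deg_le f S hS u huS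
      have := hd k hk
      have := d2 i hi
      omega

lemma good_univ {n : ℕ} (f : Fin n → ℂ[X]) (hn : 0 < n) (hne : ∀ i, f i ≠ 0)
    (hsum : ∑ i, f i = 0)
    (hsub : ∀ S : Finset (Fin n), S.Nonempty → S ≠ Finset.univ → ∑ i ∈ S, f i ≠ 0) :
    Good f Finset.univ := by
  classical
  have key : ∀ k : ℕ, ∀ S : Finset (Fin n), S.Nonempty → Good f S → n - S.card = k →
      Good f Finset.univ := by
    intro k
    induction k using Nat.strong_induction_on with
    | _ k ih =>
    intro S hS hG hk
    by_cases hSu : S = Finset.univ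
    · rwa [← hSu]
    obtain ⟨S', hss, hG'⟩ := good_step f hne hsum hsub S hS hSu hG
    have h1 := Finset.card_lt_card hss
    have h2 := Finset.card_le_univ S'
    rw [Fintype.card_fin] at h2
    exact ih (n - S'.card) (by omega) S' (hS.mono hss.1) hG' rfl
  exact key _ {⟨0, hn⟩} (Finset.singleton_nonempty _) (good_singleton f hne _) rfl

lemma prod_pow_dvd (T : Finset ℂ) (v : ℂ → ℕ) (p : ℂ[X])
    (h : ∀ a ∈ T, (X - C a) ^ v a ∣ p) : ∏ a ∈ T, (X - C a) ^ v a ∣ p := by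
  refine Finset.prod_dvd_of_coprime ?_ h
  intro a _ b _ hab
  exact (isCoprime_X_sub_C_of_isUnit_sub (sub_ne_zero.2 hab).isUnit).pow

lemma natDegree_prod_pow (T : Finset ℂ) (v : ℂ → ℕ) :
    (∏ a ∈ T, (X - C a) ^ v a : ℂ[X]).natDegree = ∑ a ∈ T, v a := by
  rw [natDegree_prod _ _ fun a _ => pow_ne_zero _ (X_sub_C_ne_zero a)]
  simp

lemma sum_min_le_rE (e : ℕ) (g : ℂ[X]) (hg : g ≠ 0) :
    ∑ a ∈ g.roots.toFinset, min (g.rootMultiplicity a) e ≤ rE e g := by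
  have h0 : radE e g ≠ 0 := by
    intro h
    exact hg (EuclideanDomain.gcd_eq_zero_iff.1 h).1
  rw [← natDegree_prod_pow, rE]
  refine natDegree_le_of_dvd (EuclideanDomain.dvd_gcd ?_ ?_) h0
  · exact prod_pow_dvd _ _ _ fun a _ =>
      (pow_dvd_pow _ (min_le_left _ _)).trans (pow_rootMultiplicity_dvd _ _)
  · exact prod_pow_dvd _ _ _ fun a ha =>
      (pow_dvd_pow _ (min_le_right _ _)).trans (pow_dvd_pow_of_dvd (Finset.dvd_prod_of_mem _ ha) _)

theorem stmt7 (n : ℕ) (hn : 3 ≤ n) (f : Fin n → ℂ[X]) (hne : ∀ i, f i ≠ 0)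
    (hconst : ¬ ∀ i, (f i).natDegree = 0)
    (hgcd : ∀ p : ℂ[X], (∀ i, p ∣ f i) → IsUnit p)
    (hsum : ∑ i, f i = 0)
    (hsub : ∀ S : Finset (Fin n), S.Nonempty → S ≠ Finset.univ → ∑ i ∈ S, f i ≠ 0)
    (d : ℕ) (hd : d = Module.finrank ℂ (Submodule.span ℂ (Set.range f))) :
    ∃ σ : ℕ, 1 ≤ σ ∧ σ ≤ d * (d - 1) / 2 ∧
      ∀ m, ((f m).natDegree : ℤ) ≤ (rE σ (∏ i, f i) : ℤ) - (σ : ℤ) := by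
  obtain ⟨W, σ, D, hW, hD, hσ, hDle, hm, hdeg⟩ := good_univ f (by omega) hne hsum hsub
  rw [Finset.coe_univ, Set.image_univ, ← hd] at hDle
  set g := ∏ i, f i with hgdef
  have hg : g ≠ 0 := Finset.prod_ne_zero_iff.2 fun i _ => hne i
  have hgm : ∀ a, g.rootMultiplicity a = ∑ i, (f i).rootMultiplicity a := by
    intro a
    rw [← count_roots, hgdef, roots_prod _ _ hg, Multiset.count_bind]
    simp only [count_roots]
    rfl
  have hgd : g.natDegree = ∑ i, (f i).natDegree := natDegree_prod _ _ fun i _ => hne i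
  have hloc : ∀ a, g.rootMultiplicity a ≤ W.rootMultiplicity a + σ := by
    intro a
    have : ∃ i, ¬ (X - C a) ∣ f i := by
      by_contra! h
      exact not_isUnit_X_sub_C a (hgcd _ h)
    obtain ⟨i, hi⟩ := this
    have h1 := hm a i (Finset.mem_univ _)
    rw [rootMultiplicity_eq_zero (fun h => hi (dvd_iff_isRoot.2 h)), ← hgm] at h1
    omega
  have hgs : g.natDegree = ∑ a ∈ g.roots.toFinset, g.rootMultiplicity a := by
    rw [(IsAlgClosed.splits g).natDegree_eq_card_roots, ← Multiset.toFinset_sum_count_eq]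
    simp
  have hWs : ∑ a ∈ g.roots.toFinset, W.rootMultiplicity a ≤ W.natDegree := by
    rw [← natDegree_prod_pow]
    exact natDegree_le_of_dvd (prod_pow_dvd _ _ _ fun a _ => pow_rootMultiplicity_dvd _ _) hW
  have hle : g.natDegree ≤ rE σ g + W.natDegree := by
    calc g.natDegree = ∑ a ∈ g.roots.toFinset, g.rootMultiplicity a := hgs
      _ ≤ ∑ a ∈ g.roots.toFinset, (min (g.rootMultiplicity a) σ + W.rootMultiplicity a) :=
        Finset.sum_le_sum fun a _ => by have := hloc a; omega
      _ ≤ _ := by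
        rw [Finset.sum_add_distrib]
        exact add_le_add (sum_min_le_rE σ g hg) hWs
  have hfin : ∀ m, (f m).natDegree + σ ≤ rE σ g := by
    intro m
    have := hdeg m (Finset.mem_univ _)
    omega
  refine ⟨σ, ?_, ?_, ?_⟩
  · by_contra h0
    have h0 : σ = 0 := by omega
    subst h0
    have hr : rE 0 g = 0 := by
      have h1 : radE 0 g ∣ 1 := by
        have := EuclideanDomain.gcd_dvd_right g (rad g ^ 0)
        rwa [pow_zero] at this
      exact natDegree_eq_zero_of_isUnit (isUnit_of_dvd_one h1)
    exact hconst fun i => by have := hfin i; omega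
  · rw [Nat.le_div_iff_mul_le (by norm_num), mul_comm]
    exact hσ.trans (Nat.mul_le_mul hDle (by omega))
  · intro m
    have := hfin m
    omega
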